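/- For every even positive integer 2m, there exists a reduced knot projection P (given by its Gauss code) such that i(P) = 2m. -/

import Mathlib

open List

/-- A (cyclic) word over the alphabet of crossings, representing a Gauss code. -/
abbrev Word := List ℕ

/-- A diagram: a finite multiset of cyclic words (its components). -/
abbrev Diagram := Multiset Word

/-- `w` is cyclically of the form `v`, i.e. some rotation of `w` equals `v`. -/
def CyclicForm (w v : Word) : Prop := ∃ n, w.rotate n = v

/-- A Gauss code of a knot projection: a nonempty cyclic double occurrence word,
in which every crossing occurs exactly twice. -/
def IsKnotProj (w : Word) : Prop := w ≠ [] ∧ ∀ a ∈ w, w.count a = 2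

/-- The crossing `a` is nugatory in `w`: `w` is cyclically of the form `a·u·a·v`
where no crossing occurs once in `u` and once in `v`. -/
def Nugatory (a : ℕ) (w : Word) : Prop :=
  ∃ u v, CyclicForm w ([a] ++ u ++ [a] ++ v) ∧
    ∀ x : ℕ, ¬ (u.count x = 1 ∧ v.count x = 1)

/-- A word is reducible when it has a nugatory crossing. -/
def Reducible (w : Word) : Prop := ∃ a, Nugatory a w

/-- A single splice at the crossing `a` on a diagram
(`s = true`: Seifert splice, `s = false`: non-Seifert splice).
At a self-crossing `a` of a component `a·u·a·v`, the Seifert splice replaces it by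
the two words `u`, `v`, the non-Seifert splice by the single word `u·reverse v`.
At a crossing shared by two components `a·p`, `a·q`, the Seifert splice merges them
into `p·q` (orientation-respecting concatenation), the non-Seifert splice into
`p·reverse q` (concatenation with one factor reversed). -/
def Splice (s : Bool) (a : ℕ) (D D' : Diagram) : Prop :=
  (∃ w u v, w ∈ D ∧ CyclicForm w ([a] ++ u ++ [a] ++ v) ∧
      D' = if s then u ::ₘ v ::ₘ D.erase w
           else (u ++ v.reverse) ::ₘ D.erase w) ∨
  (∃ w₁ w₂ p q, w₁ ∈ D ∧ w₂ ∈ D.erase w₁ ∧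
      CyclicForm w₁ ([a] ++ p) ∧ CyclicForm w₂ ([a] ++ q) ∧
      D' = (if s then p ++ q else p ++ q.reverse) ::ₘ (D.erase w₁).erase w₂)

/-- Sequential application of the listed splices (type, crossing) to a diagram. -/
def SpliceSeq : List (Bool × ℕ) → Diagram → Diagram → Prop
  | [], D, D' => D' = D
  | (s, a) :: L, D, D' => ∃ D'', Splice s a D D'' ∧ SpliceSeq L D'' D'

/-- `n` splices of the allowed kinds, applied simultaneously (i.e. at pairwise
distinct crossings) to the knot projection `w`, yield the single-component word `w'`. -/
def SimulSplice (allowed : Bool → Prop) (n : ℕ) (w w' : Word) : Prop :=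
  ∃ L : List (Bool × ℕ), L.length = n ∧ (L.map Prod.snd).Nodup ∧
    (∀ p ∈ L, allowed p.1) ∧ SpliceSeq L {w} {w'}

/-- `t(P)`: the minimum number of splices (of either type), applied simultaneously,
needed to obtain a single-component reducible word from `w`. -/
noncomputable def tRed (w : Word) : ℕ :=
  sInf {n | ∃ w', SimulSplice (fun _ => True) n w w' ∧ Reducible w'}

/-- `y(P)`: the minimum number of non-Seifert splices, applied simultaneously,
needed to obtain a single-component reducible word from `w`. -/
noncomputable def yRed (w : Word) : ℕ :=
  sInf {n | ∃ w', SimulSplice (fun s => s = false) n w w' ∧ Reducible w'}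

/-- `i(P)`: the minimum number of Seifert splices, applied simultaneously,
needed to obtain a single-component reducible word from `w`. -/
noncomputable def iRed (w : Word) : ℕ :=
  sInf {n | ∃ w', SimulSplice (fun s => s = true) n w w' ∧ Reducible w'}

/-- One non-Seifert splice at a self-crossing of a knot projection:
`a·u·a·v` becomes `u·reverse v`. -/
def NonSeifert1 (w w' : Word) : Prop :=
  ∃ a u v, CyclicForm w ([a] ++ u ++ [a] ++ v) ∧ w' = u ++ v.reverse

/-- `n` non-Seifert splices applied recursively (one at a time). -/
def NonSeifertIter : ℕ → Word → Word → Prop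
  | 0, w, w' => w' = w
  | n + 1, w, w' => ∃ w'', NonSeifert1 w w'' ∧ NonSeifertIter n w'' w'

/-- Shimizu's reductivity `r(P)`: the minimum number of non-Seifert splices,
applied recursively, needed to obtain a reducible knot projection from `w`. -/
noncomputable def rRed (w : Word) : ℕ :=
  sInf {n | ∃ w', NonSeifertIter n w w' ∧ Reducible w'}

theorem rotate_append_self (l : List ℕ) (n : ℕ) :
    (l ++ l).rotate n = l.rotate n ++ l.rotate n := by
  induction n generalizing l with
  | zero => simp
  | succ n ih =>
    cases l with
    | nil => simp
    | cons x t =>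
      have h := ih (t ++ [x])
      simpa [List.rotate_cons_succ] using h

/-- Cutting a rotation of `l ++ l` at a crossing `a` gives two copies of the same word,
provided that `l` has no repeated crossing. -/
theorem CyclicForm.exists_of_append_self {l u v : Word} {a : ℕ} (hl : l.Nodup)
    (h : CyclicForm (l ++ l) ([a] ++ u ++ [a] ++ v)) : u = v ∧ l ~r (a :: u) := by
  obtain ⟨n, hn⟩ := h
  rw [rotate_append_self] at hn
  have hnd : (l.rotate n).Nodup := List.nodup_rotate.2 hl
  rcases hr : l.rotate n with _ | ⟨b, t⟩
  · simp [hr] at hn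
  · rw [hr] at hn hnd
    simp only [List.cons_append, List.nil_append, List.append_assoc, List.cons.injEq] at hn
    obtain ⟨rfl, hn⟩ := hn
    have hbt : b ∉ t := (List.nodup_cons.1 hnd).1
    have hc := congrArg (List.count b) hn
    simp only [List.count_append, List.count_cons_self, List.count_eq_zero_of_not_mem hbt] at hc
    have hbu : b ∉ u := List.count_eq_zero.1 (by omega)
    have hbv : b ∉ v := List.count_eq_zero.1 (by omega)
    obtain ⟨rfl, -, rfl⟩ := (List.append_cons_inj_of_notMem hbu hbv).1 hn.symm
    exact ⟨rfl, n, hr⟩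

/-- Two rotations of a word without repeated crossings that start with the same crossing agree. -/
theorem List.Nodup.eq_of_isRotated_cons {p q : Word} {a : ℕ} (hp : (a :: p).Nodup)
    (h : (a :: p) ~r (a :: q)) : p = q := by
  obtain ⟨n, hn, h⟩ := List.isRotated_iff_mod.1 h
  rcases Nat.lt_or_ge n (a :: p).length with hlt | hge
  · have h0 : (a :: p)[n] = (a :: p)[0] := by
      have h1 := List.getElem_rotate (a :: p) n 0 (by simp)
      simp only [h, Nat.zero_add, Nat.mod_eq_of_lt hlt] at h1
      simpa using h1.symm
    obtain rfl : n = 0 := (hp.getElem_inj_iff).1 h0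
    simpa using h
  · obtain rfl : n = (a :: p).length := le_antisymm hn hge
    simpa using h

/-- A Seifert splice of the closed two-strand diagram carried by `l` (either one component
`l ++ l` or two components `l`) gives the other kind of diagram on one crossing fewer. -/
theorem Splice.twoStrand {D D' : Diagram} {l : Word} {a : ℕ} (hl : l.Nodup)
    (hD : D = {l ++ l} ∨ D = {l, l}) (h : Splice true a D D') :
    ∃ t : Word, t.Nodup ∧ t.length + 1 = l.length ∧ (D' = {t ++ t} ∨ D' = {t, t}) := by
  have key : ∀ t : Word, l ~r (a :: t) → t.Nodup ∧ t.length + 1 = l.length := fun t ht =>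
    ⟨(List.nodup_cons.1 (ht.nodup_iff.1 hl)).2, by simpa using ht.perm.length_eq.symm⟩
  rcases hD with rfl | rfl
  · rcases h with ⟨w, u, v, hw, hc, hD'⟩ | ⟨w₁, w₂, p, q, hw₁, hw₂, -⟩
    · obtain rfl := Multiset.mem_singleton.1 hw
      obtain ⟨rfl, hr⟩ := hc.exists_of_append_self hl
      obtain ⟨h1, h2⟩ := key u hr
      exact ⟨u, h1, h2, Or.inr (by simp [hD'])⟩
    · obtain rfl := Multiset.mem_singleton.1 hw₁
      simp at hw₂
  · rcases h with ⟨w, u, v, hw, hc, -⟩ | ⟨w₁, w₂, p, q, hw₁, hw₂, hc₁, hc₂, hD'⟩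
    · obtain rfl : w = l := by simpa using hw
      have hnd := (show w ~r _ from hc).nodup_iff.1 hl
      simp at hnd
    · obtain rfl : w₁ = l := by simpa using hw₁
      have hw₂' : w₂ = w₁ := by simpa using hw₂
      subst hw₂'
      have h1 : w₂ ~r (a :: p) := hc₁
      have h2 : w₂ ~r (a :: q) := hc₂
      obtain rfl := (h1.nodup_iff.1 hl).eq_of_isRotated_cons (h1.symm.trans h2)
      obtain ⟨h3, h4⟩ := key p h1
      exact ⟨p, h3, h4, Or.inl (by simp [hD'])⟩

theorem SpliceSeq.twoStrand {L : List (Bool × ℕ)} {D D' : Diagram} {l : Word} (hl : l.Nodup)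
    (hD : D = {l ++ l} ∨ D = {l, l}) (hL : ∀ p ∈ L, p.1 = true) (h : SpliceSeq L D D') :
    ∃ t : Word, t.Nodup ∧ t.length + L.length = l.length ∧ (D' = {t ++ t} ∨ D' = {t, t}) := by
  induction L generalizing D l with
  | nil => exact ⟨l, hl, by simp, by rwa [show D' = D from h]⟩
  | cons x L ih =>
    obtain ⟨s, a⟩ := x
    obtain rfl : s = true := hL (s, a) (by simp)
    obtain ⟨D'', h1, h2⟩ := h
    obtain ⟨t, ht, hlen, hD''⟩ := h1.twoStrand hl hD
    obtain ⟨t', ht', hlen', hD'⟩ := ih ht hD'' (fun p hp => hL p (by simp [hp])) h2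
    exact ⟨t', ht', by simp; omega, hD'⟩

theorem Reducible.length_eq_one {l : Word} (hl : l.Nodup) (h : Reducible (l ++ l)) :
    l.length = 1 := by
  obtain ⟨a, u, v, hc, hx⟩ := h
  obtain ⟨rfl, hr⟩ := hc.exists_of_append_self hl
  have hu : u.Nodup := (List.nodup_cons.1 (hr.nodup_iff.1 hl)).2
  rcases u with _ | ⟨b, u⟩
  · simpa using hr.perm.length_eq
  · exact absurd ⟨List.count_eq_one_of_mem hu (by simp), List.count_eq_one_of_mem hu (by simp)⟩
      (hx b)

theorem splice_append_self (a : ℕ) (t : Word) :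
    Splice true a {(a :: t) ++ (a :: t)} {t, t} :=
  Or.inl ⟨_, t, t, Multiset.mem_singleton_self _, ⟨0, by simp⟩, by simp⟩

theorem splice_pair (a : ℕ) (t : Word) : Splice true a {a :: t, a :: t} {t ++ t} :=
  Or.inr ⟨a :: t, a :: t, t, t, by simp, by simp, ⟨0, by simp⟩, ⟨0, by simp⟩, by simp⟩

theorem spliceSeq_range' (k m : ℕ) :
    ∃ c, SpliceSeq ((List.range' k (2 * m)).map (Prod.mk true))
      {List.range' k (2 * m + 1) ++ List.range' k (2 * m + 1)} {[c] ++ [c]} := by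
  induction m generalizing k with
  | zero => exact ⟨k, rfl⟩
  | succ m ih =>
    obtain ⟨c, hc⟩ := ih (k + 1 + 1)
    exact ⟨c, _, splice_append_self k _, _, splice_pair (k + 1) _, hc⟩

/-- For every even positive integer `2m`, there exists a reduced knot
projection `P` with `i(P) = 2m`. -/
theorem exists_reduced_iRed_eq (m : ℕ) (hm : 0 < m) :
    ∃ w : Word, IsKnotProj w ∧ ¬ Reducible w ∧ iRed w = 2 * m := by
  set l := List.range' 0 (2 * m + 1) with hldef
  have hl : l.Nodup := List.nodup_range'
  have hlen : l.length = 2 * m + 1 := by simp [hldef]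
  refine ⟨l ++ l, ⟨?_, fun a ha => ?_⟩, fun h => ?_, ?_⟩
  · rw [← List.length_pos_iff, List.length_append]
    omega
  · have ha' : a ∈ l := by simpa using ha
    rw [List.count_append, List.count_eq_one_of_mem hl ha']
  · have := h.length_eq_one hl
    omega
  · have hset : {n | ∃ w', SimulSplice (fun s => s = true) n (l ++ l) w' ∧ Reducible w'} =
        {2 * m} := by
      refine Set.eq_singleton_iff_unique_mem.2 ⟨?_, ?_⟩
      · obtain ⟨c, hc⟩ := spliceSeq_range' 0 m
        refine ⟨[c] ++ [c], ⟨_, by simp, ?_, by simp, hc⟩, c, [], [], ⟨0, by simp⟩, by simp⟩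
        simpa [Function.comp_def] using List.nodup_range'
      · rintro n ⟨w', ⟨L, rfl, -, hL, hseq⟩, hred⟩
        obtain ⟨t, ht, htl, hD | hD⟩ := hseq.twoStrand hl (Or.inl rfl) hL
        · rw [Multiset.singleton_inj] at hD
          subst hD
          have := hred.length_eq_one ht
          omega
        · exact absurd (congrArg Multiset.card hD) (by simp)
    rw [iRed, hset, csInf_singleton]
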